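/- Let n > 2. Then for every φ ∈ C_c^∞(B), ( ∫_B d² φ² λ^n dx ) ( ∫_B |∇φ|² λ^{n-2} dx ) ≥ (n²/4) ( ∫_B φ² λ^n dx )². (In hyperbolic notation: (∫ d² φ² dV)(∫ |∇_ℍ φ|² dV) ≥ (n²/4)(∫ φ² dV)².) -/

import Mathlib

open MeasureTheory

/-- Conformal factor of the Poincaré ball model. -/
noncomputable def lam {n : ℕ} (x : EuclideanSpace ℝ (Fin n)) : ℝ := 2 / (1 - ‖x‖ ^ 2)

/-- Hyperbolic distance to the origin in the Poincaré ball model. -/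
noncomputable def dH {n : ℕ} (x : EuclideanSpace ℝ (Fin n)) : ℝ :=
  Real.log ((1 + ‖x‖) / (1 - ‖x‖))

open Metric Set Topology

/-- The function `s ↦ 2 * artanh (√s) / √s`, as a power series in `s`. -/
noncomputable def distQuotient (s : ℝ) : ℝ :=
  FormalMultilinearSeries.ofScalarsSum (fun k : ℕ => (2 : ℝ) * (1 / (2 * k + 1))) s

lemma analyticAt_distQuotient {s : ℝ} (hs : |s| < 1) : AnalyticAt ℝ distQuotient s := by
  set p := FormalMultilinearSeries.ofScalars ℝ (fun k : ℕ => (2 : ℝ) * (1 / (2 * k + 1)))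
  have hp : (1 : NNReal) ≤ p.radius := by
    refine p.le_radius_of_bound 2 fun k => ?_
    rw [FormalMultilinearSeries.ofScalars_norm]
    have h : (1 : ℝ) / (2 * k + 1) ≤ 1 := by
      rw [div_le_one (by positivity)]
      linarith [(Nat.cast_nonneg k : (0 : ℝ) ≤ k)]
    rw [Real.norm_of_nonneg (by positivity)]
    simp only [NNReal.coe_one, one_pow, mul_one]
    linarith
  refine p.analyticOnNhd s (Metric.eball_subset_eball hp ?_)
  simpa [Metric.mem_eball, edist_zero_right, enorm_eq_nnnorm, ← NNReal.coe_lt_coe] using hs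

lemma distQuotient_eq_tsum (s : ℝ) :
    distQuotient s = ∑' k : ℕ, (2 : ℝ) * (1 / (2 * k + 1)) * s ^ k := by
  simp [distQuotient, FormalMultilinearSeries.ofScalars_sum_eq]

lemma mul_distQuotient_sq {r : ℝ} (hr : |r| < 1) :
    r * distQuotient (r ^ 2) = Real.log (1 + r) - Real.log (1 - r) := by
  rw [← (Real.hasSum_log_sub_log_of_abs_lt_one hr).tsum_eq, distQuotient_eq_tsum, ← tsum_mul_left]
  congr 1 with k
  ring

lemma two_le_distQuotient {s : ℝ} (h₀ : 0 ≤ s) (h₁ : s < 1) : 2 ≤ distQuotient s := by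
  rw [distQuotient_eq_tsum]
  have hsum : Summable fun k : ℕ => (2 : ℝ) * (1 / (2 * k + 1)) * s ^ k := by
    refine Summable.of_nonneg_of_le (fun k => by positivity) (fun k => ?_)
      ((summable_geometric_of_lt_one h₀ h₁).mul_left 2)
    gcongr
    rw [mul_le_iff_le_one_right two_pos, div_le_one (by positivity)]
    linarith [(Nat.cast_nonneg k : (0 : ℝ) ≤ k)]
  simpa using hsum.le_tsum 0 fun k _ => by positivity

/-- The differential equation satisfied by `distQuotient`. -/
lemma distQuotient_add_deriv {s : ℝ} (h₀ : 0 ≤ s) (h₁ : s < 1) :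
    distQuotient s + 2 * s * deriv distQuotient s = 2 / (1 - s) := by
  rcases h₀.eq_or_lt with rfl | hs
  · rw [distQuotient_eq_tsum, tsum_eq_single 0 (by intro k hk; simp [hk])]
    simp
  obtain ⟨r, hr, rfl⟩ : ∃ r : ℝ, 0 < r ∧ s = r ^ 2 :=
    ⟨√s, Real.sqrt_pos.2 hs, (Real.sq_sqrt h₀).symm⟩
  have hr₁ : r < 1 := by nlinarith
  have hd : HasDerivAt distQuotient (deriv distQuotient (r ^ 2)) (r ^ 2) :=
    (analyticAt_distQuotient (by rwa [abs_of_nonneg h₀])).differentiableAt.hasDerivAt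
  have hl := (hasDerivAt_id r).mul
    (HasDerivAt.comp (h := fun r : ℝ => r ^ 2) r hd (hasDerivAt_pow 2 r))
  have hlog : HasDerivAt (fun r : ℝ => Real.log (1 + r) - Real.log (1 - r))
      (1 / (1 + r) - -1 / (1 - r)) r :=
    (((hasDerivAt_id r).const_add 1).log (by simp; linarith)).sub
      (((hasDerivAt_id r).const_sub 1).log (by simp; linarith))
  have heq : (fun r : ℝ => Real.log (1 + r) - Real.log (1 - r)) =ᶠ[𝓝 r]
      (id * (distQuotient ∘ fun r : ℝ => r ^ 2)) := by
    filter_upwards [Ioo_mem_nhds hr hr₁] with t ht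
    simp [mul_distQuotient_sq (abs_lt.2 ⟨by linarith [ht.1], ht.2⟩)]
  have := (hl.congr_of_eventuallyEq heq).unique hlog
  have h1 : 1 - r ≠ 0 := by linarith
  have h2 : 1 + r ≠ 0 := by linarith
  have h3 : 1 - r ^ 2 ≠ 0 := by linarith
  simp at this
  have e : 2 / (1 - r ^ 2) = (1 + r)⁻¹ - -1 / (1 - r) := by
    field_simp
    ring
  rw [e, ← this]
  ring

/-- The vector field `x ↦ radialProfile n (‖x‖ ^ 2) • x` is `λ ^ n` times the hyperbolic gradient
of half the squared distance to the origin. -/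
noncomputable def radialProfile (n : ℕ) (s : ℝ) : ℝ :=
  distQuotient s * (2 / (1 - s)) ^ (n - 1)

lemma contDiffAt_radialProfile (n : ℕ) {s : ℝ} (h₀ : 0 ≤ s) (h₁ : s < 1) :
    ContDiffAt ℝ 1 (radialProfile n) s := by
  refine (analyticAt_distQuotient (by rwa [abs_of_nonneg h₀])).contDiffAt.mul (ContDiffAt.pow ?_ _)
  exact contDiffAt_const.div (contDiffAt_const.sub contDiffAt_id) (by simp; linarith)

/-- Lower bound for the divergence of the radial field, i.e. `Δ (d ^ 2 / 2) ≥ n`. -/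
lemma le_radialProfile_div {n : ℕ} (hn : 1 ≤ n) {s : ℝ} (h₀ : 0 ≤ s) (h₁ : s < 1) :
    n * (2 / (1 - s)) ^ n ≤ n * radialProfile n s + 2 * s * deriv (radialProfile n) s := by
  obtain ⟨m, rfl⟩ : ∃ m, n = m + 1 := ⟨n - 1, by omega⟩
  have hs : 0 < 1 - s := by linarith
  have hd : HasDerivAt distQuotient (deriv distQuotient s) s :=
    (analyticAt_distQuotient (by rwa [abs_of_nonneg h₀])).differentiableAt.hasDerivAt
  have hL : HasDerivAt (fun s : ℝ => 2 / (1 - s)) (2 / (1 - s) / (1 - s)) s := by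
    refine ((hasDerivAt_const s (2 : ℝ)).div ((hasDerivAt_id s).const_sub 1) hs.ne').congr_deriv ?_
    simp [div_div, sq]
  have hg : deriv (radialProfile (m + 1)) s = deriv distQuotient s * (2 / (1 - s)) ^ m +
      distQuotient s * (m * (2 / (1 - s)) ^ m / (1 - s)) := by
    have h := (hd.mul (hL.pow m)).deriv
    have h' : radialProfile (m + 1) = distQuotient * (fun s : ℝ => 2 / (1 - s)) ^ m := rfl
    rw [h', h]
    rcases m with _ | m
    · simp
    · simp only [Pi.pow_apply, Nat.add_sub_cancel, pow_succ]
      ring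
  have hA := two_le_distQuotient h₀ h₁
  have ho := distQuotient_add_deriv h₀ h₁
  have key : 2 / (1 - s) ≤ distQuotient s * ((1 + s) / (1 - s)) := by
    rw [mul_div_assoc', div_le_div_iff_of_pos_right hs]
    nlinarith
  have e : distQuotient s * ((1 + s) / (1 - s)) =
      distQuotient s + 2 * s * distQuotient s / (1 - s) := by
    field_simp
    ring
  rw [e] at key
  rw [hg, radialProfile, Nat.add_sub_cancel]
  have hfin : (2 / (1 - s)) ^ m * (m * (2 / (1 - s))) ≤
      (2 / (1 - s)) ^ m * (m * (distQuotient s + 2 * s * distQuotient s / (1 - s))) := by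
    gcongr
  have e2 : ((m + 1 : ℕ) : ℝ) * (2 / (1 - s)) ^ (m + 1) =
      (2 / (1 - s)) ^ m * (m * (2 / (1 - s))) +
      (2 / (1 - s)) ^ m * (distQuotient s + 2 * s * deriv distQuotient s) := by
    rw [ho]; push_cast; ring
  rw [e2]
  refine (add_le_add_left hfin _).trans_eq ?_
  push_cast
  ring

/-- The divergence theorem for the field `x ↦ u x • x`. -/
lemma integral_div_smul_id_eq_zero {n : ℕ} {u : EuclideanSpace ℝ (Fin n) → ℝ}
    (hu : ContDiff ℝ 1 u) (hc : HasCompactSupport u) :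
    ∫ x, (fderiv ℝ u x x + n * u x) = 0 := by
  have hdiff : Differentiable ℝ u := hu.differentiable one_ne_zero
  have hcont (v : EuclideanSpace ℝ (Fin n) → EuclideanSpace ℝ (Fin n)) (hv : Continuous v) :
      Continuous fun x => fderiv ℝ u x (v x) :=
    (hu.continuous_fderiv one_ne_zero).clm_apply hv
  have hsupp : HasCompactSupport (fderiv ℝ u) := hc.fderiv ℝ
  have hcoord (i : Fin n) : Continuous fun x : EuclideanSpace ℝ (Fin n) => x i := by fun_prop
  have hder (i : Fin n) (x : EuclideanSpace ℝ (Fin n)) :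
      fderiv ℝ (fun y => u y * y i) x (EuclideanSpace.single i 1) =
        fderiv ℝ u x (EuclideanSpace.single i 1) * x i + u x := by
    have h : HasFDerivAt (fun y : EuclideanSpace ℝ (Fin n) => u y * y i) _ x :=
      (hdiff x).hasFDerivAt.mul (EuclideanSpace.proj (𝕜 := ℝ) i).hasFDerivAt
    rw [h.fderiv]
    simp [add_comm, mul_comm]
  have hcs (i : Fin n) : HasCompactSupport fun x => fderiv ℝ u x (EuclideanSpace.single i 1) :=
    hsupp.comp_left 
      (g := fun L : EuclideanSpace ℝ (Fin n) →L[ℝ] ℝ => L (EuclideanSpace.single i 1)) rfl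
  have hIntOn (i : Fin n) : Integrable fun x : EuclideanSpace ℝ (Fin n) =>
      fderiv ℝ u x (EuclideanSpace.single i 1) * x i + u x :=
    (((hcont _ continuous_const).mul (hcoord i)).integrable_of_hasCompactSupport
      (hcs i).mul_right).add (hu.continuous.integrable_of_hasCompactSupport hc)
  have hzero (i : Fin n) :
      ∫ x : EuclideanSpace ℝ (Fin n),
        (fderiv ℝ u x (EuclideanSpace.single i 1) * x i + u x) = 0 := by
    have h := integral_mul_fderiv_eq_neg_fderiv_mul_of_integrable (𝕜 := ℝ)
      (μ := (volume : Measure (EuclideanSpace ℝ (Fin n)))) (f := fun y => u y * y i)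
      (g := fun _ => 1) (v := EuclideanSpace.single i 1)
      (by simpa [hder] using hIntOn i) (by simp)
      (by
        simp only [mul_one]
        exact (hu.continuous.mul (hcoord i)).integrable_of_hasCompactSupport hc.mul_right)
      (fun x _ => (hdiff x).mul (by fun_prop)) (fun x _ => by fun_prop)
    simpa [hder] using h.symm
  have hsum (x : EuclideanSpace ℝ (Fin n)) : fderiv ℝ u x x + n * u x =
      ∑ i, (fderiv ℝ u x (EuclideanSpace.single i 1) * x i + u x) := by
    have hx : x = ∑ i, x i • EuclideanSpace.single i (1 : ℝ) := by
      ext j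
      simp [Pi.single_apply]
    rw [Finset.sum_add_distrib]
    conv_lhs => enter [1, 2]; rw [hx]
    simp [map_sum, mul_comm]
  simp_rw [hsum]
  rw [integral_finsetSum _ fun i _ => hIntOn i]
  simp [hzero]

/-- A function which is continuous on an open set and vanishes off a compact subset of it is
integrable. -/
lemma integrable_of_continuousOn_of_eq_zero {n : ℕ} {f : EuclideanSpace ℝ (Fin n) → ℝ}
    {K U : Set (EuclideanSpace ℝ (Fin n))} (hK : IsCompact K) (hKU : K ⊆ U)
    (hf : ContinuousOn f U) (h : ∀ x ∉ K, f x = 0) : Integrable f :=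
  (integrableOn_iff_integrable_of_support_subset (Function.support_subset_iff'.2 h)).1
    ((hf.mono hKU).integrableOn_compact hK)

lemma lam_pos {n : ℕ} {x : EuclideanSpace ℝ (Fin n)} (hx : ‖x‖ < 1) : 0 < lam x := by
  have := norm_nonneg x
  exact div_pos two_pos (by nlinarith)

lemma dH_sq {n : ℕ} {x : EuclideanSpace ℝ (Fin n)} (hx : ‖x‖ < 1) :
    dH x ^ 2 = ‖x‖ ^ 2 * distQuotient (‖x‖ ^ 2) ^ 2 := by
  have := norm_nonneg x
  rw [dH, Real.log_div (by linarith) (by linarith),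
    ← mul_distQuotient_sq (by rwa [abs_of_nonneg this]), mul_pow]

/-- Sharp Heisenberg–Pauli–Weyl uncertainty principle inequality on hyperbolic
space (Theorem 4.2, inequality part). -/
theorem uncertainty_principle_hyperbolic {n : ℕ} (hn : 2 < n)
    (φ : EuclideanSpace ℝ (Fin n) → ℝ)
    (hφ_smooth : ContDiff ℝ (⊤ : ℕ∞) φ) (hφ_cpt : HasCompactSupport φ)
    (hφ_supp : tsupport φ ⊆ Metric.ball (0 : EuclideanSpace ℝ (Fin n)) 1) :
    (n : ℝ) ^ 2 / 4 *
        (∫ x in Metric.ball (0 : EuclideanSpace ℝ (Fin n)) 1,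
          φ x ^ 2 * lam x ^ (n : ℝ)) ^ 2 ≤
      (∫ x in Metric.ball (0 : EuclideanSpace ℝ (Fin n)) 1,
          dH x ^ 2 * φ x ^ 2 * lam x ^ (n : ℝ)) *
        ∫ x in Metric.ball (0 : EuclideanSpace ℝ (Fin n)) 1,
          ‖gradient φ x‖ ^ 2 * lam x ^ ((n : ℝ) - 2) := by
  set U := Metric.ball (0 : EuclideanSpace ℝ (Fin n)) 1 with hU
  have hnorm {x : EuclideanSpace ℝ (Fin n)} (hx : x ∈ U) : ‖x‖ < 1 := by simpa [hU] using hx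
  have hsq {x : EuclideanSpace ℝ (Fin n)} (hx : x ∈ U) : ‖x‖ ^ 2 < 1 := by
    nlinarith [hnorm hx, norm_nonneg x]
  have hφ0 {x : EuclideanSpace ℝ (Fin n)} (hx : x ∉ tsupport φ) : φ x = 0 :=
    image_eq_zero_of_notMem_tsupport hx
  have hdφ0 {x : EuclideanSpace ℝ (Fin n)} (hx : x ∉ tsupport φ) : fderiv ℝ φ x = 0 :=
    image_eq_zero_of_notMem_tsupport fun h => hx (tsupport_fderiv_subset ℝ h)
  have hφd : Differentiable ℝ φ := hφ_smooth.differentiable (by simp)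
  have hφc : ContinuousOn φ U := hφ_smooth.continuous.continuousOn
  have hdφc : Continuous (fderiv ℝ φ) := hφ_smooth.continuous_fderiv (by simp)
  have hgradc : Continuous (gradient φ) :=
    (InnerProductSpace.toDual ℝ (EuclideanSpace ℝ (Fin n))).symm.continuous.comp hdφc
  have hlamc (a : ℝ) : ContinuousOn (fun x : EuclideanSpace ℝ (Fin n) => lam x ^ a) U := by
    refine ContinuousOn.rpow_const ?_ fun x hx => Or.inl (lam_pos (hnorm hx)).ne'
    exact continuousOn_const.div (by fun_prop) fun x hx => by linarith [hsq hx]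
  have hdc : ContinuousOn (dH (n := n)) U := by
    refine ContinuousOn.log (ContinuousOn.div (by fun_prop) (by fun_prop) fun x hx => ?_)
      fun x hx => ?_
    · linarith [hnorm hx]
    · exact (div_pos (by linarith [norm_nonneg x]) (by linarith [hnorm hx])).ne'
  have hGc : ∀ x ∈ U, ContDiffAt ℝ 1
      (fun x : EuclideanSpace ℝ (Fin n) => radialProfile n (‖x‖ ^ 2)) x := fun x hx =>
    (contDiffAt_radialProfile n (sq_nonneg _) (hsq hx)).comp x (contDiff_norm_sq ℝ).contDiffAt
  set u := fun x : EuclideanSpace ℝ (Fin n) => φ x ^ 2 * radialProfile n (‖x‖ ^ 2) with hu_def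
  set W := fun x : EuclideanSpace ℝ (Fin n) =>
    2 * φ x * radialProfile n (‖x‖ ^ 2) * fderiv ℝ φ x x with hW_def
  have hu : ContDiff ℝ 1 u := by
    rw [contDiff_iff_contDiffAt]
    intro x
    by_cases hx : x ∈ U
    · exact ((hφ_smooth.of_le (by simp)).contDiffAt.pow 2).mul (hGc x hx)
    · have h0 : u =ᶠ[𝓝 x] fun _ => 0 := by
        filter_upwards [notMem_tsupport_iff_eventuallyEq.1 fun h => hx (hφ_supp h)] with y hy
        simp [hu_def, hy]
      exact contDiffAt_const.congr_of_eventuallyEq h0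
  have hu0 : ∀ x ∉ tsupport φ, u x = 0 := fun x hx => by simp [hu_def, hφ0 hx]
  have hucpt : HasCompactSupport u := HasCompactSupport.intro hφ_cpt hu0
  have hdiv0 : ∀ x ∉ tsupport φ, fderiv ℝ u x x + n * u x = 0 := by
    intro x hx
    have h0 : u =ᶠ[𝓝 x] fun _ => 0 := by
      filter_upwards [notMem_tsupport_iff_eventuallyEq.1 hx] with y hy
      simp [hu_def, hy]
    simp [h0.fderiv_eq, hu0 x hx]
  have hIntOn {f : EuclideanSpace ℝ (Fin n) → ℝ} (hf : ContinuousOn f U)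
      (h : ∀ x ∉ tsupport φ, f x = 0) : IntegrableOn f U :=
    (integrable_of_continuousOn_of_eq_zero hφ_cpt hφ_supp hf h).integrableOn
  have hI : IntegrableOn (fun x => φ x ^ 2 * lam x ^ (n : ℝ)) U :=
    hIntOn ((hφc.pow 2).mul (hlamc _)) fun x hx => by simp [hφ0 hx]
  have hP : IntegrableOn (fun x => dH x ^ 2 * φ x ^ 2 * lam x ^ (n : ℝ)) U :=
    hIntOn (((hdc.pow 2).mul (hφc.pow 2)).mul (hlamc _)) fun x hx => by simp [hφ0 hx]
  have hQ : IntegrableOn (fun x => ‖gradient φ x‖ ^ 2 * lam x ^ ((n : ℝ) - 2)) U :=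
    hIntOn ((hgradc.norm.continuousOn.pow 2).mul (hlamc _)) fun x hx => by
      simp [gradient, hdφ0 hx]
  have hW : IntegrableOn W U :=
    hIntOn (((continuousOn_const.mul hφc).mul fun x hx => (hGc x hx).continuousAt.continuousWithinAt).mul
      (hdφc.clm_apply continuous_id).continuousOn) fun x hx => by simp [hW_def, hφ0 hx]
  have hD : IntegrableOn (fun x => fderiv ℝ u x x + n * u x) U :=
    hIntOn (((hu.continuous_fderiv one_ne_zero).clm_apply continuous_id).add
      (continuous_const.mul hu.continuous)).continuousOn hdiv0
  have hD0 : ∫ x in U, (fderiv ℝ u x x + n * u x) = 0 := by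
    rw [setIntegral_eq_integral_of_forall_compl_eq_zero
      fun x hx => hdiv0 x fun h => hx (hφ_supp h)]
    exact integral_div_smul_id_eq_zero hu hucpt
  have hle : ∀ x ∈ U, n * (φ x ^ 2 * lam x ^ (n : ℝ)) + W x ≤ fderiv ℝ u x x + n * u x := by
    intro x hx
    have hG : HasDerivAt (radialProfile n) (deriv (radialProfile n) (‖x‖ ^ 2)) (‖x‖ ^ 2) :=
      ((contDiffAt_radialProfile n (sq_nonneg _) (hsq hx)).differentiableAt
        one_ne_zero).hasDerivAt
    have h : HasFDerivAt u _ x := ((hφd x).hasFDerivAt.pow 2).mul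
      (hG.comp_hasFDerivAt (f := fun x : EuclideanSpace ℝ (Fin n) => ‖x‖ ^ 2) x
        (hasStrictFDerivAt_norm_sq x).hasFDerivAt)
    have hfd : fderiv ℝ u x x =
        W x + φ x ^ 2 * (2 * ‖x‖ ^ 2 * deriv (radialProfile n) (‖x‖ ^ 2)) := by
      rw [h.fderiv]
      simp [hW_def]
      ring
    have hmain := mul_le_mul_of_nonneg_left
      (le_radialProfile_div (by omega : 1 ≤ n) (sq_nonneg ‖x‖) (hsq hx)) (sq_nonneg (φ x))
    rw [hfd, Real.rpow_natCast, lam]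
    simp only [hu_def]
    linarith
  have hquad : ∀ t : ℝ, ∀ x ∈ U, 0 ≤ t * t * (dH x ^ 2 * φ x ^ 2 * lam x ^ (n : ℝ)) + t * W x +
      ‖gradient φ x‖ ^ 2 * lam x ^ ((n : ℝ) - 2) := by
    intro t x hx
    have hL := lam_pos (hnorm hx)
    have h := norm_add_sq_real (gradient φ x) ((t * φ x * distQuotient (‖x‖ ^ 2) * lam x) • x)
    rw [inner_smul_right, inner_gradient_left, norm_smul, mul_pow, Real.norm_eq_abs, sq_abs] at h
    have h0 : 0 ≤ ‖gradient φ x + (t * φ x * distQuotient (‖x‖ ^ 2) * lam x) • x‖ ^ 2 *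
        lam x ^ (n - 2) := by positivity
    rw [h] at h0
    obtain ⟨m, rfl⟩ : ∃ m, n = m + 2 := ⟨n - 2, by omega⟩
    have hcast : ((m + 2 : ℕ) : ℝ) - 2 = m := by push_cast; ring
    rw [hcast, Real.rpow_natCast, Real.rpow_natCast, dH_sq (hnorm hx)]
    simp only [hW_def, radialProfile]
    rw [← lam]
    refine h0.trans_eq ?_
    simp only [Nat.add_sub_cancel, show m + 2 - 1 = m + 1 from rfl]
    ring
  set I := ∫ x in U, φ x ^ 2 * lam x ^ (n : ℝ)
  set P := ∫ x in U, dH x ^ 2 * φ x ^ 2 * lam x ^ (n : ℝ)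
  set Q := ∫ x in U, ‖gradient φ x‖ ^ 2 * lam x ^ ((n : ℝ) - 2)
  have hI0 : 0 ≤ I := setIntegral_nonneg measurableSet_ball fun x hx =>
    mul_nonneg (sq_nonneg _) (Real.rpow_nonneg (lam_pos (hnorm hx)).le _)
  have hIW : n * I + ∫ x in U, W x ≤ 0 := by
    rw [← hD0, ← integral_const_mul, ← integral_add (hI.const_mul _) hW]
    exact setIntegral_mono_on ((hI.const_mul _).add hW) hD measurableSet_ball hle
  have hdisc : discrim P (∫ x in U, W x) Q ≤ 0 := by
    refine discrim_le_zero fun t => ?_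
    have h := setIntegral_nonneg (μ := volume) measurableSet_ball (hquad t)
    have hPW : IntegrableOn (fun x => t * t * (dH x ^ 2 * φ x ^ 2 * lam x ^ (n : ℝ)) + t * W x) U :=
      (hP.const_mul _).add (hW.const_mul _)
    rw [integral_add hPW hQ, integral_add (hP.const_mul _) (hW.const_mul _), integral_const_mul, integral_const_mul] at h
    linarith
  rw [discrim] at hdisc
  have hnI : 0 ≤ n * I := by positivity
  nlinarith
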